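/- arXiv:math/0404344 — 4 statements merged into one kernel-verified Lean document; each statement's English description precedes it below -/
import Mathlib

section
/- Let E and F be real normed spaces and T : E → F a linear map, not assumed continuous. If for every C^∞ curve γ : ℝ → E with γ(0) = 0 the composite T ∘ γ : ℝ → F is continuous at 0, then T is continuous (equivalently, bounded). -/
open Filter Topology in
/-- A bump function at `1` with all its derivatives. -/
lemma exists_bump_seq : ∃ ψ : ℕ → ℝ → ℝ,
    (∀ k x, HasDerivAt (ψ k) (ψ (k+1) x) x) ∧
    (∀ k x, ψ k x ≠ 0 → 3/4 ≤ x ∧ x ≤ 5/4) ∧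
    (∀ k, ∃ M, ∀ x, ‖ψ k x‖ ≤ M) ∧ ψ 0 1 = 1 := by
  let b : ContDiffBump (1:ℝ) := ⟨1/8, 1/4, by norm_num, by norm_num⟩
  have hb : ContDiff ℝ (⊤ : ℕ∞) b := b.contDiff
  have hd : ∀ k x, HasDerivAt (iteratedDeriv k b) (iteratedDeriv (k+1) b x) x := by
    intro k x
    rw [iteratedDeriv_succ]
    have := hb.differentiable_iteratedDeriv k (by exact_mod_cast WithTop.coe_lt_top k)
    exact (this x).hasDerivAt
  have hs : ∀ k x, iteratedDeriv k b x ≠ 0 → x ∈ Metric.closedBall (1:ℝ) (1/4) := by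
    intro k x hx
    have h1 : iteratedFDeriv ℝ k b x ≠ 0 := by
      intro h0
      apply hx
      rw [iteratedDeriv_eq_iteratedFDeriv, h0]; simp
    have := support_iteratedFDeriv_subset (𝕜 := ℝ) k h1
    rwa [b.tsupport_eq] at this
  refine ⟨fun k => iteratedDeriv k b, hd, ?_, ?_, ?_⟩
  · intro k x hx
    have := hs k x hx
    rw [Metric.mem_closedBall, Real.dist_eq, abs_le] at this
    constructor <;> linarith
  · intro k
    have hc : Continuous (iteratedDeriv k b) :=
      continuous_iff_continuousAt.2 fun x => (hd k x).continuousAt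
    refine HasCompactSupport.exists_bound_of_continuous ?_ hc
    exact HasCompactSupport.intro (isCompact_closedBall (1:ℝ) (1/4))
      fun x hx => by_contra fun h => hx (hs k x h)
  · simp only [iteratedDeriv_zero]
    exact b.one_of_mem_closedBall (Metric.mem_closedBall_self b.rIn_pos.le)

lemma dyadic_unique {m n : ℕ} {t : ℝ} (hm : 3/4 ≤ 2^m * t ∧ 2^m * t ≤ 5/4)
    (hn : 3/4 ≤ 2^n * t ∧ 2^n * t ≤ 5/4) : m = n := by
  have key : ∀ {m n : ℕ}, (3/4 ≤ 2^m * t ∧ 2^m * t ≤ 5/4) →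
      (3/4 ≤ 2^n * t ∧ 2^n * t ≤ 5/4) → ¬ m < n := by
    intro m n hm hn hlt
    have ht : 0 < t := by
      have : 0 < 2^m * t := by linarith [hm.1]
      exact pos_of_mul_pos_right this (by positivity)
    have h1 : (2:ℝ)^(m+1) ≤ 2^n := pow_le_pow_right₀ (by norm_num) hlt
    have h2 := mul_le_mul_of_nonneg_right h1 ht.le
    rw [pow_succ] at h2
    nlinarith [hm.1, hn.2]
  rcases lt_trichotomy m n with h | h | h
  · exact absurd h (key hm hn)
  · exact h
  · exact absurd h (key hn hm)

open Filter Topology in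
/-- Smooth curve through a rapidly decreasing sequence (no completeness needed). -/
lemma exists_smooth_curve {E : Type*} [NormedAddCommGroup E] [NormedSpace ℝ E]
    (x : ℕ → E) (hx : ∀ n, 2^(n^2) * ‖x n‖ ≤ 1) :
    ∃ γ : ℝ → E, ContDiff ℝ (⊤ : ℕ∞) γ ∧ γ 0 = 0 ∧ ∀ n : ℕ, γ ((1/2)^n) = x n := by
  obtain ⟨ψ, hd, hs, hM, h1⟩ := exists_bump_seq
  let f : ℕ → ℕ → ℝ → E := fun k n t => (((2:ℝ)^n)^k * ψ k (2^n * t)) • x n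
  let g : ℕ → ℝ → E := fun k t => ∑' n, f k n t
  have hf : ∀ k n t, f k n t ≠ 0 → 3/4 ≤ 2^n * t ∧ 2^n * t ≤ 5/4 := by
    intro k n t h
    apply hs k
    intro h0
    exact h (by simp [f, h0])
  have hg : ∀ k t n, (3/4 ≤ 2^n * t ∧ 2^n * t ≤ 5/4) → g k t = f k n t := by
    intro k t n hn
    refine tsum_eq_single n fun m hmn => ?_
    by_contra h
    exact hmn (dyadic_unique (hf k m t h) hn)
  have hg0 : ∀ k t, (∀ n, f k n t = 0) → g k t = 0 := by
    intro k t h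
    simp [g, h]
  have hgz : ∀ k, g k 0 = 0 := by
    intro k
    apply hg0
    intro n
    by_contra h
    have := (hf k n 0 h).1
    norm_num at this
  have hfd : ∀ k n t, HasDerivAt (f k n) (f (k+1) n t) t := by
    intro k n t
    have h2 : HasDerivAt (fun s : ℝ => (2:ℝ)^n * s) (2^n) t := by
      simpa using (hasDerivAt_id t).const_mul ((2:ℝ)^n)
    have h3 := (((hd k (2^n * t)).comp t h2).const_mul (((2:ℝ)^n)^k)).smul_const (x n)
    have h4 : f (k+1) n t = (((2:ℝ)^n)^k * (ψ (k+1) (2^n * t) * 2^n)) • x n := by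
      change (((2:ℝ)^n)^(k+1) * ψ (k+1) (2^n * t)) • x n = _
      rw [show ((2:ℝ)^n)^(k+1) * ψ (k+1) (2^n * t)
        = ((2:ℝ)^n)^k * (ψ (k+1) (2^n * t) * 2^n) by rw [pow_succ]; ring]
    rw [h4]
    exact h3
  have hbound : ∀ k, ∃ C, ∀ t, ‖g k t‖ ≤ C * t^2 := by
    intro k
    obtain ⟨M, hM⟩ := hM k
    have hM0 : 0 ≤ M := (norm_nonneg _).trans (hM 0)
    refine ⟨M * 2^((k+2)^2) * 4, fun t => ?_⟩
    by_cases hz : ∀ n, f k n t = 0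
    · rw [hg0 k t hz, norm_zero]; positivity
    push Not at hz
    obtain ⟨n, hn⟩ := hz
    have hr := hf k n t hn
    rw [hg k t n hr]
    have ha : (2:ℝ)^(n*(k+2)) ≤ 2^((k+2)^2) * 2^(n^2) := by
      rw [← pow_add]
      apply pow_le_pow_right₀ (by norm_num)
      nlinarith [sq_nonneg ((n:ℤ) - (k+2)), Nat.zero_le (n*(k+2)), two_mul_le_add_sq n (k+2)]
    have hb : 1 ≤ 4 * ((2:ℝ)^n * t)^2 := by nlinarith [hr.1]
    have e1 : ‖f k n t‖ ≤ ((2:ℝ)^n)^k * M * ‖x n‖ := by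
      simp only [f]
      rw [norm_smul, norm_mul, Real.norm_of_nonneg (by positivity : (0:ℝ) ≤ ((2:ℝ)^n)^k)]
      gcongr
      exact hM _
    calc ‖f k n t‖ ≤ ((2:ℝ)^n)^k * M * ‖x n‖ := e1
      _ ≤ ((2:ℝ)^n)^k * M * ‖x n‖ * (4 * ((2:ℝ)^n * t)^2) :=
          le_mul_of_one_le_right (by positivity) hb
      _ = (2:ℝ)^(n*(k+2)) * (M * ‖x n‖ * 4 * t^2) := by
          rw [pow_mul, pow_add]; ring
      _ ≤ (2^((k+2)^2) * 2^(n^2)) * (M * ‖x n‖ * 4 * t^2) := by gcongr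
      _ = (M * 2^((k+2)^2) * 4 * t^2) * (2^(n^2) * ‖x n‖) := by ring
      _ ≤ M * 2^((k+2)^2) * 4 * t^2 := mul_le_of_le_one_right (by positivity) (hx n)
  have hloc : ∀ t : ℝ, t ≠ 0 → ∃ N : ℕ, ∀ᶠ s in 𝓝 t, ∀ k n, N ≤ n → f k n s = 0 := by
    intro t ht
    rcases lt_or_gt_of_ne ht with h | h
    · refine ⟨0, ?_⟩
      filter_upwards [Iio_mem_nhds h] with s hs k n _
      by_contra h0
      have h1 := (hf k n s h0).1
      have h2 : (2:ℝ)^n * s < 0 := mul_neg_of_pos_of_neg (by positivity) hs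
      linarith
    · obtain ⟨N, hN⟩ := pow_unbounded_of_one_lt (5/4 / (t/2)) (one_lt_two : (1:ℝ) < 2)
      refine ⟨N, ?_⟩
      filter_upwards [Ioi_mem_nhds (half_lt_self h)] with s hs k n hn
      by_contra h0
      have h1 := (hf k n s h0).2
      rw [div_lt_iff₀ (by positivity)] at hN
      have h3 : (2:ℝ)^N ≤ 2^n := pow_le_pow_right₀ (by norm_num) hn
      have h4 : (2:ℝ)^N * (t/2) ≤ 2^n * s :=
        mul_le_mul h3 (le_of_lt hs) (by positivity) (by positivity)
      linarith
  have hgd : ∀ k t, HasDerivAt (g k) (g (k+1) t) t := by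
    intro k t
    by_cases ht : t = 0
    · subst ht
      rw [hgz]
      obtain ⟨C, hC⟩ := hbound k
      rw [hasDerivAt_iff_isLittleO]
      simp only [hgz, sub_zero, smul_zero]
      have h1 : (g k) =O[𝓝 0] fun t : ℝ => t^2 := by
        refine Asymptotics.IsBigO.of_bound C (Eventually.of_forall fun t => ?_)
        rw [Real.norm_of_nonneg (sq_nonneg t)]
        exact hC t
      refine h1.trans_isLittleO ?_
      simpa using (Asymptotics.isLittleO_pow_pow (𝕜 := ℝ) (one_lt_two : 1 < 2))
    · obtain ⟨N, hN⟩ := hloc t ht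
      have e : ∀ k s, (∀ k n, N ≤ n → f k n s = 0) → g k s = ∑ n ∈ Finset.range N, f k n s := by
        intro k s hs
        exact tsum_eq_sum fun n hn => hs k n (by simpa using hn)
      rw [e (k+1) t hN.self_of_nhds]
      have h1 := HasDerivAt.fun_sum (u := Finset.range N) fun n _ => hfd k n t
      refine h1.congr_of_eventuallyEq ?_
      filter_upwards [hN] with s hs using e k s hs
  have hcd : ∀ m : ℕ, ∀ k, ContDiff ℝ m (g k) := by
    intro m
    induction m with
    | zero =>
      intro k
      exact contDiff_zero.2 (continuous_iff_continuousAt.2 fun t => (hgd k t).continuousAt)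
    | succ m ih =>
      intro k
      push_cast
      rw [contDiff_succ_iff_deriv]
      refine ⟨fun t => (hgd k t).differentiableAt, by simp, ?_⟩
      have : deriv (g k) = g (k+1) := funext fun t => (hgd k t).deriv
      rw [this]
      exact ih _
  refine ⟨g 0, contDiff_infty.2 fun m => hcd m 0, hgz 0, fun n => ?_⟩
  have h2 : (2:ℝ)^n * (1/2)^n = 1 := by rw [← mul_pow]; norm_num
  rw [hg 0 _ n (by rw [h2]; norm_num)]
  simp only [f]
  rw [h2, h1]
  simp

/-- A linear map between real normed spaces taking smooth curves through `0` to curves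
continuous at `0` is continuous (bounded). -/
theorem continuous_of_comp_smooth_curves_continuousAt
    {E : Type*} [NormedAddCommGroup E] [NormedSpace ℝ E]
    {F : Type*} [NormedAddCommGroup F] [NormedSpace ℝ F]
    (T : E →ₗ[ℝ] F)
    (h : ∀ γ : ℝ → E, ContDiff ℝ (⊤ : ℕ∞) γ → γ 0 = 0 → ContinuousAt (fun t => T (γ t)) 0) :
    Continuous T := by
  by_contra hT
  have hex : ∀ n : ℕ, ∃ x : E, 2^(n^2) * ‖x‖ ≤ 1 ∧ 1 < ‖T x‖ := by
    intro n
    by_contra hno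
    push Not at hno
    apply hT
    have hb : ∀ z ∈ Metric.ball (0:E) ((2^(n^2))⁻¹), ‖T z‖ ≤ 1 := by
      intro z hz
      apply hno
      rw [mem_ball_zero_iff, inv_eq_one_div, lt_div_iff₀ (by positivity)] at hz
      linarith
    obtain ⟨C, hC⟩ := LinearMap.bound_of_ball_bound (𝕜 := ℝ) (by positivity) 1 T hb
    exact AddMonoidHomClass.continuous_of_bound T C hC
  choose x hx hTx using hex
  obtain ⟨γ, hγ, hγ0, hγx⟩ := exists_smooth_curve x hx
  have hc := h γ hγ hγ0
  have ht : Filter.Tendsto (fun n : ℕ => ((1:ℝ)/2)^n) Filter.atTop (nhds 0) :=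
    tendsto_pow_atTop_nhds_zero_of_lt_one (by norm_num) (by norm_num)
  have h2 := (hc.tendsto.comp ht).norm
  simp only [Function.comp_def, hγx, hγ0, map_zero, norm_zero] at h2
  have := ge_of_tendsto' h2 fun n => (hTx n).le
  norm_num at this
end

section
/- Let E and F be real normed spaces, U ⊆ E open, α ∈ (0,1], and f : U → F a map. Then the following are equivalent: (a) for every C^∞ curve γ : ℝ → E with image contained in U, the composite f ∘ γ : ℝ → F is locally Hölder of exponent α; (b) for every compact set K ⊆ U there exists C ≥ 0 such that ‖f(z) − f(y)‖ ≤ C·‖z − y‖^α for all y, z ∈ K. -/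
open scoped Topology

namespace ConvHolder

def Supp (φ : ℝ → ℝ) : Prop := ∀ u, (u < 9/8 ∨ 15/8 < u) → φ u = 0

def Rapid {E : Type*} [NormedAddCommGroup E] (a : ℕ → E) : Prop :=
  ∀ k : ℕ, ∃ M : ℝ, ∀ n : ℕ, ((2:ℝ)^n)^k * ‖a n‖ ≤ M

noncomputable def G {E : Type*} [NormedAddCommGroup E] [NormedSpace ℝ E]
    (φ : ℝ → ℝ) (a : ℕ → E) (t : ℝ) : E := ∑' n : ℕ, φ (2^n * t) • a n

variable {E : Type*} [NormedAddCommGroup E] [NormedSpace ℝ E]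

lemma disj {m n : ℕ} {t : ℝ} (hn : 9/8 ≤ 2^n * t) (hn' : 2^n * t ≤ 15/8)
    (hm : 9/8 ≤ 2^m * t) (hm' : 2^m * t ≤ 15/8) : m = n := by
  have key : ∀ i j : ℕ, i < j → 9/8 ≤ (2:ℝ)^i * t → (2:ℝ)^j * t ≤ 15/8 → False := by
    intro i j hij h1 h2
    have ht : 0 < t := by
      by_contra h
      have : (2:ℝ)^i * t ≤ 0 := mul_nonpos_of_nonneg_of_nonpos (by positivity) (not_lt.1 h)
      linarith
    have h3 : (2:ℝ)^(i+1) ≤ 2^j := pow_le_pow_right₀ (by norm_num) hij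
    have h4 := mul_le_mul_of_nonneg_right h3 ht.le
    rw [pow_succ] at h4
    linarith
  rcases lt_trichotomy m n with h | h | h
  · exact (key _ _ h hm hn').elim
  · exact h
  · exact (key _ _ h hn hm').elim

lemma G_eq {φ : ℝ → ℝ} (hφ : Supp φ) (a : ℕ → E) {n : ℕ} {t : ℝ}
    (h : 9/8 ≤ 2^n * t) (h' : 2^n * t ≤ 15/8) : G φ a t = φ (2^n * t) • a n := by
  unfold G
  apply tsum_eq_single
  intro m hm
  rw [hφ, zero_smul]
  by_contra hc
  push Not at hc
  exact hm (disj h h' hc.1 hc.2)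

lemma G_cases {φ : ℝ → ℝ} (hφ : Supp φ) (a : ℕ → E) (t : ℝ) :
    G φ a t = 0 ∨ ∃ n : ℕ, 9/8 ≤ 2^n * t ∧ 2^n * t ≤ 15/8 ∧ G φ a t = φ (2^n * t) • a n := by
  by_cases h : ∃ n : ℕ, 9/8 ≤ 2^n * t ∧ 2^n * t ≤ 15/8
  · obtain ⟨n, h1, h2⟩ := h
    exact Or.inr ⟨n, h1, h2, G_eq hφ a h1 h2⟩
  · left
    unfold G
    convert tsum_zero with n
    rw [hφ, zero_smul]
    by_contra hc
    push Not at hc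
    exact h ⟨n, hc⟩

lemma Supp.deriv {φ : ℝ → ℝ} (hφ : Supp φ) : Supp (deriv φ) := by
  intro u hu
  have : φ =ᶠ[𝓝 u] fun _ => 0 := by
    rcases hu with hu | hu
    · filter_upwards [Iio_mem_nhds hu] with v hv using hφ v (Or.inl hv)
    · filter_upwards [Ioi_mem_nhds hu] with v hv using hφ v (Or.inr hv)
  rw [this.deriv_eq]; simp

lemma Supp.bdd {φ : ℝ → ℝ} (hφ : Supp φ) (hc : Continuous φ) : ∃ B, 0 ≤ B ∧ ∀ u, |φ u| ≤ B := by
  obtain ⟨C, hC⟩ := (isCompact_Icc (a := (9/8:ℝ)) (b := 15/8)).exists_bound_of_continuousOn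
    hc.continuousOn
  refine ⟨max C 0, le_max_right _ _, fun u => ?_⟩
  by_cases h : u ∈ Set.Icc (9/8:ℝ) (15/8)
  · exact (hC u h).trans (le_max_left _ _)
  · rw [hφ u]
    · simp
    · by_contra hc
      push Not at hc
      exact h hc

lemma Rapid.shift {a : ℕ → E} (ha : Rapid a) : Rapid (fun n => (2:ℝ)^n • a n) := by
  intro k
  obtain ⟨M, hM⟩ := ha (k+1)
  refine ⟨M, fun n => ?_⟩
  have := hM n
  rw [norm_smul, Real.norm_of_nonneg (by positivity)]
  rw [pow_succ, mul_assoc] at this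
  exact this

lemma hasDerivAt_G {φ : ℝ → ℝ} (hφ : Supp φ) (hd : ContDiff ℝ 1 φ) {a : ℕ → E} (ha : Rapid a)
    (t : ℝ) : HasDerivAt (G φ a) (G (deriv φ) (fun n => (2:ℝ)^n • a n) t) t := by
  rcases eq_or_ne t 0 with rfl | ht0
  · have h0 : ∀ (ψ : ℝ → ℝ) (b : ℕ → E), Supp ψ → G ψ b 0 = 0 := by
      intro ψ b hψ
      rcases G_cases hψ b 0 with h | ⟨n, h, -⟩
      · exact h
      · norm_num at h
    rw [h0 _ _ hφ.deriv]
    obtain ⟨B, hB0, hB⟩ := hφ.bdd hd.continuous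
    obtain ⟨M, hM⟩ := ha 2
    have hM0 : 0 ≤ M := le_trans (by positivity) (hM 0)
    have hb : ∀ t, ‖G φ a t‖ ≤ B * M * t^2 := by
      intro t
      rcases G_cases hφ a t with h | ⟨n, h1, h2, h⟩
      · rw [h, norm_zero]; positivity
      · rw [h, norm_smul, mul_assoc]
        have h3 : 1 ≤ (2^n * t)^2 := by nlinarith
        have h4 : ‖a n‖ ≤ M * t^2 := by
          calc ‖a n‖ ≤ (2^n * t)^2 * ‖a n‖ := le_mul_of_one_le_left (norm_nonneg _) h3
            _ = ((2^n)^2 * ‖a n‖) * t^2 := by ring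
            _ ≤ M * t^2 := by gcongr; exact hM n
        exact mul_le_mul (hB _) h4 (norm_nonneg _) hB0
    rw [hasDerivAt_iff_isLittleO]
    simp only [h0 _ _ hφ, sub_zero, smul_zero]
    have h1 : G φ a =O[𝓝 0] fun t : ℝ => t^2 := by
      refine Asymptotics.IsBigO.of_bound (B*M) (Filter.Eventually.of_forall fun t => ?_)
      simpa using hb t
    refine h1.trans_isLittleO ?_
    simpa using Asymptotics.isLittleO_pow_pow (𝕜 := ℝ) (m := 1) (n := 2) (by norm_num)
  · -- away from zero
    obtain ⟨N, hN⟩ : ∃ N : ℕ, ∀ᶠ s in 𝓝 t, ∀ n : ℕ, N ≤ n → (2^n * s < 9/8 ∨ 15/8 < 2^n * s) := by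
      rcases lt_or_gt_of_ne ht0 with h | h
      · refine ⟨0, ?_⟩
        filter_upwards [Iio_mem_nhds h] with s hs n _
        left
        have : (2:ℝ)^n * s ≤ 0 := mul_nonpos_of_nonneg_of_nonpos (by positivity) (le_of_lt hs)
        linarith
      · obtain ⟨N, hN⟩ := pow_unbounded_of_one_lt (4/t) (by norm_num : (1:ℝ) < 2)
        refine ⟨N, ?_⟩
        filter_upwards [Ioi_mem_nhds (half_lt_self h)] with s hs n hn
        right
        have h3 : (2:ℝ)^N ≤ 2^n := pow_le_pow_right₀ (by norm_num) hn
        have hs' : t/2 < s := hs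
        calc (15/8:ℝ) < 4/t * (t/2) := by field_simp; norm_num
          _ ≤ 2^n * s := by
            apply mul_le_mul (hN.le.trans h3) hs'.le (by positivity) (by positivity)
    have hfin : ∀ (ψ : ℝ → ℝ) (b : ℕ → E), Supp ψ →
        ∀ᶠ s in 𝓝 t, G ψ b s = ∑ n ∈ Finset.range N, ψ (2^n * s) • b n := by
      intro ψ b hψ
      filter_upwards [hN] with s hs
      unfold G
      apply tsum_eq_sum
      intro n hn
      rw [hψ _ (hs n (by simpa using hn)), zero_smul]
    rw [(hfin _ (fun n => (2:ℝ)^n • a n) hφ.deriv).self_of_nhds]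
    refine HasDerivAt.congr_of_eventuallyEq ?_ (hfin φ a hφ)
    apply HasDerivAt.fun_sum
    intro n _
    have h1 : HasDerivAt φ (deriv φ (2^n * t)) (2^n * t) :=
      (hd.differentiable (by norm_num) _).hasDerivAt
    have h2 : HasDerivAt (fun s : ℝ => (2:ℝ)^n * s) (2^n) t := by
      simpa using (hasDerivAt_id t).const_mul ((2:ℝ)^n)
    have h3 := (h1.comp t h2).smul_const (a n)
    rw [smul_smul]
    exact h3

lemma contDiff_G_nat (k : ℕ) : ∀ {φ : ℝ → ℝ} (_ : Supp φ) (_ : ContDiff ℝ (⊤ : ℕ∞) φ)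
    {a : ℕ → E} (_ : Rapid a), ContDiff ℝ k (G φ a) := by
  induction k with
  | zero =>
    intro φ hφ hd a ha
    have hd1 : ContDiff ℝ 1 φ := hd.of_le (by exact_mod_cast le_top)
    simp only [Nat.cast_zero, contDiff_zero]
    exact continuous_iff_continuousAt.2 fun t => (hasDerivAt_G hφ hd1 ha t).continuousAt
  | succ k ih =>
    intro φ hφ hd a ha
    have hd1 : ContDiff ℝ 1 φ := hd.of_le (by exact_mod_cast le_top)
    push_cast
    rw [contDiff_succ_iff_deriv]
    refine ⟨fun t => (hasDerivAt_G hφ hd1 ha t).differentiableAt, by simp, ?_⟩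
    have : deriv (G φ a) = G (deriv φ) (fun n => (2:ℝ)^n • a n) :=
      funext fun t => (hasDerivAt_G hφ hd1 ha t).deriv
    rw [this]
    exact ih hφ.deriv (contDiff_infty_iff_deriv.1 hd).2 ha.shift

lemma contDiff_G {φ : ℝ → ℝ} (hφ : Supp φ) (hd : ContDiff ℝ (⊤ : ℕ∞) φ)
    {a : ℕ → E} (ha : Rapid a) : ContDiff ℝ (⊤ : ℕ∞) (G φ a) :=
  contDiff_infty.2 fun k => contDiff_G_nat k hφ hd ha

lemma exists_bump : ∃ φ : ℝ → ℝ, Supp φ ∧ ContDiff ℝ (⊤ : ℕ∞) φ ∧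
    (∀ u, 5/4 ≤ u → u ≤ 7/4 → φ u = 1) ∧ ∀ u, |φ u| ≤ 1 := by
  let b : ContDiffBump (3/2:ℝ) := ⟨1/4, 3/8, by norm_num, by norm_num⟩
  refine ⟨b, ?_, b.contDiff, ?_, ?_⟩
  · intro u hu
    apply b.zero_of_le_dist
    change (3/8:ℝ) ≤ _
    rw [Real.dist_eq, le_abs]
    rcases hu with hu | hu
    · right; linarith
    · left; linarith
  · intro u h1 h2
    apply b.one_of_mem_closedBall
    change dist u (3/2) ≤ 1/4
    rw [Real.dist_eq, abs_le]
    constructor <;> linarith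
  · intro u
    rw [abs_of_nonneg b.nonneg]
    exact b.le_one

lemma norm_G_le {φ : ℝ → ℝ} (hφ : Supp φ) (hb : ∀ u, |φ u| ≤ 1) {a : ℕ → E} {M : ℝ}
    (hM : ∀ n, ‖a n‖ ≤ M) (t : ℝ) : ‖G φ a t‖ ≤ M := by
  have hM0 : 0 ≤ M := (norm_nonneg _).trans (hM 0)
  rcases G_cases hφ a t with h | ⟨n, -, -, h⟩
  · rw [h, norm_zero]; exact hM0
  · rw [h, norm_smul]
    calc _ ≤ 1 * M := mul_le_mul (hb _) (hM n) (norm_nonneg _) zero_le_one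
      _ = M := one_mul _

lemma rapid_of_le {a : ℕ → E} {r : ℝ} (hr : 0 ≤ r) (h : ∀ n : ℕ, ‖a n‖ ≤ r / n.factorial) :
    Rapid a := by
  intro k
  refine ⟨r * Real.exp (2^k), fun n => ?_⟩
  have h1 := Real.pow_div_factorial_le_exp ((2:ℝ)^k) (by positivity) n
  calc ((2:ℝ)^n)^k * ‖a n‖ ≤ ((2:ℝ)^n)^k * (r / n.factorial) := by gcongr; exact h n
    _ = r * (((2:ℝ)^k)^n / n.factorial) := by rw [pow_right_comm]; ring
    _ ≤ _ := by gcongr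

variable {F : Type*} [NormedAddCommGroup F] [NormedSpace ℝ F]

lemma local_holder {α : ℝ} (hα : α ∈ Set.Ioc (0 : ℝ) 1)
    {U : Set E} (hU : IsOpen U) (f : E → F)
    (H : ∀ γ : ℝ → E, ContDiff ℝ (⊤ : ℕ∞) γ → Set.range γ ⊆ U →
      ∀ t₀ : ℝ, ∃ V ∈ 𝓝 t₀, ∃ C ≥ (0 : ℝ),
        ∀ s ∈ V, ∀ t ∈ V, ‖f (γ t) - f (γ s)‖ ≤ C * |t - s| ^ α) {x : E} (hx : x ∈ U) :
    ∃ δ > 0, ∃ C ≥ (0:ℝ), ∀ y ∈ Metric.ball x δ, ∀ z ∈ Metric.ball x δ,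
      ‖f z - f y‖ ≤ C * ‖z - y‖ ^ α := by
  by_contra hcon
  push Not at hcon
  obtain ⟨r, hr, hrU⟩ := Metric.isOpen_iff.1 hU x hx
  let ε : ℕ → ℝ := fun n => (r/4) / n.factorial
  have hε : ∀ n, 0 < ε n := fun n => by positivity
  have hεr : ∀ n, ε n ≤ r/4 := fun n =>
    div_le_self (by positivity) (by exact_mod_cast n.factorial_pos)
  have hch := fun n : ℕ => hcon (ε n / 4) (by have := hε n; positivity)
    (n * (1 / (2^n * ε n))^α) (by have := hε n; positivity)
  choose y hy z hz hyz using hch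
  have hne : ∀ n, 0 < ‖z n - y n‖ := by
    intro n
    rw [norm_pos_iff]
    intro h
    have h1 := hyz n
    rw [sub_eq_zero] at h
    rw [h, sub_self, sub_self, norm_zero, norm_zero, Real.zero_rpow hα.1.ne', mul_zero] at h1
    exact lt_irrefl _ h1
  have hd2 : ∀ n, ‖z n - y n‖ ≤ ε n / 2 := by
    intro n
    have h1 := hy n
    have h2 := hz n
    rw [Metric.mem_ball] at h1 h2
    rw [← dist_eq_norm]
    have := dist_triangle_right (z n) (y n) x
    linarith
  let e : ℕ → ℝ := fun n => ‖z n - y n‖ / ε n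
  have he0 : ∀ n, 0 < e n := fun n => div_pos (hne n) (hε n)
  have he : ∀ n, e n ≤ 1/2 := by
    intro n
    rw [div_le_iff₀ (hε n)]
    linarith [hd2 n]
  let a : ℕ → E := fun n => y n - x
  let v : ℕ → E := fun n => (e n)⁻¹ • (z n - y n)
  have hae : ∀ n, ‖a n‖ ≤ ε n := by
    intro n
    have h1 := hy n
    rw [Metric.mem_ball, dist_eq_norm] at h1
    have := hε n
    change ‖y n - x‖ ≤ _
    linarith
  have hve : ∀ n, ‖v n‖ ≤ ε n := by
    intro n
    apply le_of_eq
    change ‖(e n)⁻¹ • (z n - y n)‖ = _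
    rw [norm_smul, Real.norm_of_nonneg (inv_nonneg.2 (he0 n).le)]
    have := (hne n).ne'
    have := (hε n).ne'
    simp only [e]
    field_simp
  obtain ⟨φ, hφ, hφd, hφ1, hφb⟩ := exists_bump
  let ψ : ℝ → ℝ := fun u => φ u * (u - 5/4)
  have hψ : Supp ψ := fun u hu => by simp only [ψ]; rw [hφ u hu, zero_mul]
  have hψd : ContDiff ℝ (⊤ : ℕ∞) ψ := hφd.mul (contDiff_id.sub contDiff_const)
  have hψb : ∀ u, |ψ u| ≤ 1 := by
    intro u
    by_cases h : u < 9/8 ∨ 15/8 < u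
    · rw [hψ u h]; simp
    · push Not at h
      simp only [ψ]
      rw [abs_mul]
      apply mul_le_one₀ (hφb u) (abs_nonneg _)
      rw [abs_le]; constructor <;> linarith [h.1, h.2]
  have ha : Rapid a := rapid_of_le (by positivity) hae
  have hv : Rapid v := rapid_of_le (by positivity) hve
  let γ : ℝ → E := fun t => x + (G φ a t + G ψ v t)
  have hγ : ContDiff ℝ (⊤ : ℕ∞) γ :=
    contDiff_const.add ((contDiff_G hφ hφd ha).add (contDiff_G hψ hψd hv))
  have hγU : Set.range γ ⊆ U := by
    rintro _ ⟨t, rfl⟩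
    apply hrU
    rw [Metric.mem_ball, dist_eq_norm]
    simp only [γ, add_sub_cancel_left]
    have h1 := norm_G_le hφ hφb (fun n => (hae n).trans (hεr n)) t
    have h2 := norm_G_le hψ hψb (fun n => (hve n).trans (hεr n)) t
    have h3 := norm_add_le (G φ a t) (G ψ v t)
    linarith
  have hval : ∀ n : ℕ, ∀ u, 5/4 ≤ u → u ≤ 7/4 →
      γ (u / 2^n) = y n + (u - 5/4) • v n := by
    intro n u h1 h2
    have hu : (2:ℝ)^n * (u / 2^n) = u := by field_simp
    simp only [γ]
    rw [G_eq hφ a (n := n) (by rw [hu]; linarith) (by rw [hu]; linarith),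
      G_eq hψ v (n := n) (by rw [hu]; linarith) (by rw [hu]; linarith), hu]
    simp only [ψ]
    rw [hφ1 u h1 h2, one_smul, one_mul]
    simp only [a]
    abel
  obtain ⟨V, hV, C, hC0, hC⟩ := H γ hγ hγU 0
  obtain ⟨ρ, hρ, hρV⟩ := Metric.mem_nhds_iff.1 hV
  obtain ⟨N, hN⟩ := pow_unbounded_of_one_lt (2/ρ) (by norm_num : (1:ℝ) < 2)
  obtain ⟨N', hN'⟩ := exists_nat_ge C
  set n := max N N' with hn
  have h2n : 2/ρ < 2^n :=
    hN.trans_le (pow_le_pow_right₀ (by norm_num) (le_max_left _ _))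
  have hnC : C ≤ n := hN'.trans (by exact_mod_cast le_max_right _ _)
  have hmem : ∀ u : ℝ, 5/4 ≤ u → u ≤ 7/4 → u / 2^n ∈ V := by
    intro u h1 h2
    apply hρV
    rw [Metric.mem_ball, dist_zero_right, Real.norm_of_nonneg (by positivity)]
    rw [div_lt_iff₀ (by positivity)]
    rw [div_lt_iff₀ hρ] at h2n
    linarith
  have hen := he n
  have hen0 := he0 n
  have hh := hC _ (hmem (5/4) le_rfl (by norm_num)) _ (hmem (5/4 + e n) (by linarith) (by linarith))
  rw [hval n _ le_rfl (by norm_num), hval n _ (by linarith) (by linarith)] at hh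
  have hz' : y n + (5/4 + e n - 5/4) • v n = z n := by
    rw [add_sub_cancel_left]
    simp only [v]
    rw [smul_smul, mul_inv_cancel₀ hen0.ne', one_smul]
    abel
  rw [hz', sub_self, zero_smul, add_zero] at hh
  have hdt : |(5/4 + e n)/2^n - 5/4/2^n| = (1 / (2^n * ε n)) * ‖z n - y n‖ := by
    rw [← sub_div, add_sub_cancel_left, abs_of_nonneg (by positivity)]
    simp only [e]
    have := (hε n).ne'
    field_simp
  have hεn := hε n
  rw [hdt, Real.mul_rpow (by positivity) (by positivity), ← mul_assoc] at hh
  have h5 := hyz n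
  have h6 : C * (1 / (2^n * ε n))^α * ‖z n - y n‖^α ≤
      n * (1 / (2^n * ε n))^α * ‖z n - y n‖^α := by gcongr
  linarith

lemma holder_compact {α : ℝ} (hα : α ∈ Set.Ioc (0 : ℝ) 1) {U : Set E} (f : E → F)
    (H : ∀ x ∈ U, ∃ δ > 0, ∃ C ≥ (0:ℝ), ∀ y ∈ Metric.ball x δ, ∀ z ∈ Metric.ball x δ,
      ‖f z - f y‖ ≤ C * ‖z - y‖ ^ α) {K : Set E} (hKU : K ⊆ U) (hK : IsCompact K) :
    ∃ C ≥ (0 : ℝ), ∀ y ∈ K, ∀ z ∈ K, ‖f z - f y‖ ≤ C * ‖z - y‖ ^ α := by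
  have hcont : ∀ x ∈ U, ContinuousAt f x := by
    intro x hx
    obtain ⟨δ, hδ, C, hC0, hC⟩ := H x hx
    rw [ContinuousAt, tendsto_iff_norm_sub_tendsto_zero]
    have hlim : Filter.Tendsto (fun z => C * ‖z - x‖ ^ α) (𝓝 x) (𝓝 0) := by
      have h1 : ContinuousAt (fun z => C * ‖z - x‖ ^ α) x := by
        apply ContinuousAt.mul continuousAt_const
        apply ContinuousAt.rpow_const (by fun_prop) (Or.inr hα.1.le)
      have h2 := h1.tendsto
      simpa [Real.zero_rpow hα.1.ne'] using h2
    refine squeeze_zero' (Filter.Eventually.of_forall fun _ => norm_nonneg _) ?_ hlim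
    filter_upwards [Metric.ball_mem_nhds x hδ] with z hz
    exact hC x (Metric.mem_ball_self hδ) z hz
  have key : ∃ C ≥ (0:ℝ), ∀ q ∈ K ×ˢ K, ‖f q.2 - f q.1‖ ≤ C * ‖q.2 - q.1‖ ^ α := by
    refine (hK.prod hK).induction_on
      (p := fun S => ∃ C ≥ (0:ℝ), ∀ q ∈ S, ‖f q.2 - f q.1‖ ≤ C * ‖q.2 - q.1‖ ^ α) ?_ ?_ ?_ ?_
    · exact ⟨0, le_rfl, by simp⟩
    · rintro S T hST ⟨C, h0, h⟩
      exact ⟨C, h0, fun q hq => h q (hST hq)⟩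
    · rintro S T ⟨C, h0, h⟩ ⟨D, k0, k⟩
      refine ⟨max C D, le_max_of_le_left h0, ?_⟩
      rintro q (hq | hq)
      · exact (h q hq).trans (by gcongr; exact le_max_left _ _)
      · exact (k q hq).trans (by gcongr; exact le_max_right _ _)
    · rintro ⟨y, z⟩ ⟨hy, hz⟩
      simp only at hy hz
      by_cases hyz : y = z
      · subst hyz
        obtain ⟨δ, hδ, C, hC0, hC⟩ := H y (hKU hy)
        refine ⟨Metric.ball y δ ×ˢ Metric.ball y δ, mem_nhdsWithin_of_mem_nhds
          (prod_mem_nhds (Metric.ball_mem_nhds y hδ) (Metric.ball_mem_nhds y hδ)), C, hC0, ?_⟩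
        rintro ⟨p, q⟩ ⟨hp, hq⟩
        exact hC p hp q hq
      · have hpos : 0 < ‖z - y‖ := norm_pos_iff.2 (sub_ne_zero.2 (Ne.symm hyz))
        have hf1 : ContinuousAt (fun q : E × E => f q.1) (y, z) :=
          ContinuousAt.comp (f := Prod.fst) (hcont y (hKU hy)) continuousAt_fst
        have hf2 : ContinuousAt (fun q : E × E => f q.2) (y, z) :=
          ContinuousAt.comp (f := Prod.snd) (hcont z (hKU hz)) continuousAt_snd
        have hn : ContinuousAt (fun q : E × E => ‖q.2 - q.1‖) (y, z) := by fun_prop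
        have hq : ContinuousAt (fun q : E × E => ‖f q.2 - f q.1‖ / ‖q.2 - q.1‖ ^ α) (y, z) :=
          (hf2.sub hf1).norm.div (hn.rpow_const (Or.inr hα.1.le)) (Real.rpow_pos_of_pos hpos _).ne'
        have e1 := hq.eventually (Iio_mem_nhds (lt_add_one _))
        have e2 := hn.eventually (Ioi_mem_nhds hpos)
        refine ⟨_, mem_nhdsWithin_of_mem_nhds (e1.and e2),
          ‖f z - f y‖ / ‖z - y‖ ^ α + 1, ?_, ?_⟩
        · positivity
        · rintro q ⟨h1, h2⟩
          have h2' : 0 < ‖q.2 - q.1‖ := h2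
          exact (div_le_iff₀ (Real.rpow_pos_of_pos h2' _)).1 (le_of_lt h1)
  obtain ⟨C, h0, h⟩ := key
  exact ⟨C, h0, fun y hy z hz => h (y, z) ⟨hy, hz⟩⟩

end ConvHolder

/-- A map `f : U → F` on an open subset of a normed space takes smooth curves (with image
in `U`) to locally `α`-Hölder curves if and only if it satisfies a uniform `α`-Hölder
estimate on every compact subset of `U`. -/
theorem conveniently_holder_iff_holder_on_compacts
    {E : Type*} [NormedAddCommGroup E] [NormedSpace ℝ E]
    {F : Type*} [NormedAddCommGroup F] [NormedSpace ℝ F]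
    {α : ℝ} (hα : α ∈ Set.Ioc (0 : ℝ) 1)
    {U : Set E} (hU : IsOpen U) (f : E → F) :
    (∀ γ : ℝ → E, ContDiff ℝ (⊤ : ℕ∞) γ → Set.range γ ⊆ U →
      ∀ t₀ : ℝ, ∃ V ∈ 𝓝 t₀, ∃ C ≥ (0 : ℝ),
        ∀ s ∈ V, ∀ t ∈ V, ‖f (γ t) - f (γ s)‖ ≤ C * |t - s| ^ α) ↔
    (∀ K : Set E, K ⊆ U → IsCompact K →
      ∃ C ≥ (0 : ℝ), ∀ y ∈ K, ∀ z ∈ K, ‖f z - f y‖ ≤ C * ‖z - y‖ ^ α) := by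
  constructor
  · intro H K hKU hK
    exact ConvHolder.holder_compact hα f
      (fun x hx => ConvHolder.local_holder hα hU f H hx) hKU hK
  · intro H γ hγ hγU t₀
    have hγ1 : ContDiff ℝ 1 γ := hγ.of_le (by exact_mod_cast le_top)
    obtain ⟨L, W, hW, hL⟩ := (hγ1.contDiffAt (x := t₀)).exists_lipschitzOnWith
    obtain ⟨C, hC0, hC⟩ := H (γ '' Metric.closedBall t₀ 1)
      ((Set.image_subset_range _ _).trans hγU)
      ((isCompact_closedBall t₀ 1).image hγ.continuous)
    refine ⟨W ∩ Metric.closedBall t₀ 1,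
      Filter.inter_mem hW (Metric.closedBall_mem_nhds t₀ one_pos), C * (L:ℝ)^α, by positivity, ?_⟩
    intro s hs t ht
    refine (hC _ ⟨s, hs.2, rfl⟩ _ ⟨t, ht.2, rfl⟩).trans ?_
    rw [mul_assoc, ← Real.mul_rpow (by positivity) (by positivity)]
    have h1 := hL.dist_le_mul t ht.1 s hs.1
    rw [dist_eq_norm, Real.dist_eq] at h1
    have := hα.1.le
    gcongr
end

section
/- Let E and F be real normed spaces, U ⊆ E open, α ∈ (0,1], and f : U → F a map such that f ∘ γ is locally Hölder of exponent α for every C^∞ curve γ : ℝ → E with image contained in U. Then f ∘ η is locally Hölder of exponent α for every Lipschitz continuous curve η : ℝ → E with image contained in U. -/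
open scoped Topology NNReal

lemma glue_aux {E : Type*} [NormedAddCommGroup E] [NormedSpace ℝ E]
    (h : ℕ → ℕ → ℝ → E) (ρ : ℝ) (hρ : 0 ≤ ρ)
    (hd : ∀ n k t, HasDerivAt (h n k) (h n (k+1) t) t)
    (hs : ∀ n k t, t ∉ Metric.closedBall ((1/2:ℝ)^n) ((1/2:ℝ)^n/4) → h n k t = 0)
    (hb : ∀ n k, k ≤ n → ∀ t, ‖h n k t‖ ≤ ρ * (1/4:ℝ)^n) :
    ∃ G : ℝ → E, ContDiff ℝ (⊤ : ℕ∞) G ∧ (∀ t, ‖G t‖ ≤ ρ) ∧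
      ∀ n, ∀ t ∈ Metric.closedBall ((1/2:ℝ)^n) ((1/2:ℝ)^n/4), G t = h n 0 t := by
  have key : ∀ n t, t ∈ Metric.closedBall ((1/2:ℝ)^n) ((1/2:ℝ)^n/4) →
      3/4 * (1/2:ℝ)^n ≤ t ∧ t ≤ 5/4 * (1/2:ℝ)^n := by
    intro n t ht
    rw [Metric.mem_closedBall, Real.dist_eq, abs_le] at ht
    constructor <;> linarith [ht.1, ht.2]
  have lt_aux : ∀ m n t, t ∈ Metric.closedBall ((1/2:ℝ)^n) ((1/2:ℝ)^n/4) →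
      t ∈ Metric.closedBall ((1/2:ℝ)^m) ((1/2:ℝ)^m/4) → ¬ m < n := by
    intro m n t hn hm hlt
    have h1 := key n t hn
    have h2 := key m t hm
    have h3 : (1/2:ℝ)^n ≤ (1/2:ℝ)^(m+1) :=
      pow_le_pow_of_le_one (by norm_num) (by norm_num) hlt
    have h4 : (0:ℝ) < (1/2:ℝ)^m := by positivity
    rw [pow_succ] at h3
    linarith [h1.2, h2.1]
  have uniq : ∀ m n t, t ∈ Metric.closedBall ((1/2:ℝ)^n) ((1/2:ℝ)^n/4) →
      t ∈ Metric.closedBall ((1/2:ℝ)^m) ((1/2:ℝ)^m/4) → m = n := by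
    intro m n t hn hm
    have h1 := lt_aux m n t hn hm
    have h2 := lt_aux n m t hm hn
    omega
  have hsingle : ∀ n k t, t ∈ Metric.closedBall ((1/2:ℝ)^n) ((1/2:ℝ)^n/4) →
      ∑ᶠ n, h n k t = h n k t := by
    intro n k t ht
    apply finsum_eq_single
    intro m hm
    apply hs
    intro h'
    exact hm (uniq m n t ht h')
  have hzero : ∀ k t, (∀ n, t ∉ Metric.closedBall ((1/2:ℝ)^n) ((1/2:ℝ)^n/4)) →
      ∑ᶠ n, h n k t = 0 := by
    intro k t ht
    rw [← finsum_zero (α := ℕ)]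
    exact finsum_congr fun n => hs n k t (ht n)
  -- derivative
  have hG : ∀ k t, HasDerivAt (fun t => ∑ᶠ n, h n k t) (∑ᶠ n, h n (k+1) t) t := by
    intro k t
    rcases lt_trichotomy t 0 with ht | ht | ht
    · have : ∀ s < (0:ℝ), ∀ n, s ∉ Metric.closedBall ((1/2:ℝ)^n) ((1/2:ℝ)^n/4) := by
        intro s hs n hn
        have := (key n s hn).1
        have h4 : (0:ℝ) < (1/2:ℝ)^n := by positivity
        linarith
      rw [hzero _ _ (this t ht)]
      refine (hasDerivAt_const t (0:E)).congr_of_eventuallyEq ?_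
      filter_upwards [Iio_mem_nhds ht] with s hs'
      exact hzero _ _ (this s hs')
    · subst ht
      have z0 : ∀ n, (0:ℝ) ∉ Metric.closedBall ((1/2:ℝ)^n) ((1/2:ℝ)^n/4) := by
        intro n hn
        have := (key n 0 hn).1
        have h4 : (0:ℝ) < (1/2:ℝ)^n := by positivity
        linarith
      rw [hzero _ _ z0]
      rw [hasDerivAt_iff_isLittleO]
      have hO : (fun t => (∑ᶠ n, h n k t)) =O[𝓝 (0:ℝ)] (fun t : ℝ => t^2) := by
        refine Asymptotics.IsBigO.of_bound (4*ρ) ?_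
        have h4 : (0:ℝ) < 1/2 * (1/2:ℝ)^k := by positivity
        filter_upwards [Iio_mem_nhds h4] with s hs'
        by_cases hex : ∃ n, s ∈ Metric.closedBall ((1/2:ℝ)^n) ((1/2:ℝ)^n/4)
        · obtain ⟨n, hn⟩ := hex
          rw [hsingle n k s hn]
          have hk := key n s hn
          have hkn : k ≤ n := by
            by_contra hc
            have h3 : (1/2:ℝ)^k ≤ (1/2:ℝ)^n :=
              pow_le_pow_of_le_one (by norm_num) (by norm_num) (by omega)
            have : s < 1/2 * (1/2:ℝ)^k := hs'
            have h4 : (0:ℝ) < (1/2:ℝ)^n := by positivity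
            linarith [hk.1]
          refine (hb n k hkn s).trans ?_
          have e : (1/4:ℝ)^n = ((1/2:ℝ)^n)^2 := by
            rw [← pow_mul, mul_comm, pow_mul]; norm_num
          have h4 : (0:ℝ) < (1/2:ℝ)^n := by positivity
          rw [e, Real.norm_of_nonneg (sq_nonneg s)]
          have : ((1/2:ℝ)^n)^2 ≤ 4 * s^2 := by nlinarith [hk.1]
          nlinarith
        · push Not at hex
          rw [hzero _ _ hex, norm_zero]
          positivity
      have := hO.trans_isLittleO (Asymptotics.isLittleO_pow_id (𝕜 := ℝ) (n := 2) (by norm_num))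
      simpa [hzero _ _ z0] using this
    · obtain ⟨N, hN⟩ := exists_pow_lt_of_lt_one (show (0:ℝ) < t/4 by linarith)
        (show (1/2:ℝ) < 1 by norm_num)
      have fin : ∀ k, ∀ s > t/2, ∑ᶠ n, h n k s = ∑ n ∈ Finset.range N, h n k s := by
        intro k s hs'
        apply finsum_eq_sum_of_support_subset
        intro n hn
        simp only [Function.mem_support] at hn
        have hm : s ∈ Metric.closedBall ((1/2:ℝ)^n) ((1/2:ℝ)^n/4) := by
          by_contra hc
          exact hn (hs n k s hc)
        have := (key n s hm).2
        simp only [Finset.coe_range, Set.mem_Iio]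
        by_contra hc
        have h3 : (1/2:ℝ)^n ≤ (1/2:ℝ)^N :=
              pow_le_pow_of_le_one (by norm_num) (by norm_num) (by omega)
        linarith
      rw [fin _ t (by linarith)]
      refine HasDerivAt.congr_of_eventuallyEq
        (HasDerivAt.fun_sum (u := Finset.range N) fun n _ => hd n k t) ?_
      filter_upwards [Ioi_mem_nhds (show t/2 < t by linarith)] with s hs'
      exact fin k s hs'
  refine ⟨fun t => ∑ᶠ n, h n 0 t, ?_, ?_, fun n t ht => hsingle n 0 t ht⟩
  · have : ∀ m : ℕ, ∀ k, ContDiff ℝ m (fun t => ∑ᶠ n, h n k t) := by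
      intro m
      induction m with
      | zero =>
        intro k
        exact contDiff_zero.2 (continuous_iff_continuousAt.2 fun t => (hG k t).continuousAt)
      | succ m ih =>
        intro k
        have : deriv (fun t => ∑ᶠ n, h n k t) = fun t => ∑ᶠ n, h n (k+1) t :=
          funext fun t => (hG k t).deriv
        push_cast
        rw [contDiff_succ_iff_deriv]
        refine ⟨fun t => (hG k t).differentiableAt, by simp, ?_⟩
        rw [this]
        exact ih (k+1)
    exact contDiff_infty.2 fun m => this m 0
  · intro t
    by_cases hex : ∃ n, t ∈ Metric.closedBall ((1/2:ℝ)^n) ((1/2:ℝ)^n/4)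
    · obtain ⟨n, hn⟩ := hex
      simp only [hsingle n 0 t hn]
      refine (hb n 0 (Nat.zero_le _) t).trans ?_
      exact mul_le_of_le_one_right hρ (pow_le_one₀ (by norm_num) (by norm_num))
    · push Not at hex
      simpa [hzero _ _ hex] using hρ

lemma scalar_aux : ∃ A B : ℕ → ℕ → ℝ → ℝ,
    (∀ n k t, HasDerivAt (A n k) (A n (k+1) t) t) ∧
    (∀ n k t, HasDerivAt (B n k) (B n (k+1) t) t) ∧
    (∀ n k t, t ∉ Metric.closedBall ((1/2:ℝ)^n) ((1/2:ℝ)^n/4) → A n k t = 0) ∧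
    (∀ n k t, t ∉ Metric.closedBall ((1/2:ℝ)^n) ((1/2:ℝ)^n/4) → B n k t = 0) ∧
    (∀ n, ∀ t ∈ Metric.closedBall ((1/2:ℝ)^n) ((1/2:ℝ)^n/8),
      A n 0 t = 1 ∧ B n 0 t = t - (1/2:ℝ)^n) ∧
    ∃ M : ℕ → ℝ, (∀ n, 0 < M n) ∧ ∀ n k, k ≤ n → ∀ t, |A n k t| ≤ M n ∧ |B n k t| ≤ M n := by
  have hp : ∀ n : ℕ, (0:ℝ) < (1/2:ℝ)^n := fun n => by positivity
  let φ : ∀ n : ℕ, ContDiffBump ((1/2:ℝ)^n) := fun n =>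
    ⟨(1/2:ℝ)^n/8, (1/2:ℝ)^n/4, by have := hp n; linarith, by have := hp n; linarith⟩
  let a : ℕ → ℝ → ℝ := fun n => φ n
  let b : ℕ → ℝ → ℝ := fun n t => φ n t * (t - (1/2:ℝ)^n)
  have ha : ∀ n, ContDiff ℝ (⊤ : ℕ∞) (a n) := fun n => (φ n).contDiff
  have hb : ∀ n, ContDiff ℝ (⊤ : ℕ∞) (b n) := fun n =>
    (ha n).mul (contDiff_id.sub contDiff_const)
  have hta : ∀ n, tsupport (a n) ⊆ Metric.closedBall ((1/2:ℝ)^n) ((1/2:ℝ)^n/4) := fun n =>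
    (φ n).tsupport_eq.le
  have htb : ∀ n, tsupport (b n) ⊆ Metric.closedBall ((1/2:ℝ)^n) ((1/2:ℝ)^n/4) := fun n =>
    (tsupport_mul_subset_left (f := a n) (g := fun t => t - (1/2:ℝ)^n)).trans (hta n)
  have gd : ∀ g : ℝ → ℝ, ContDiff ℝ (⊤ : ℕ∞) g → ∀ k t,
      HasDerivAt (iteratedDeriv k g) (iteratedDeriv (k+1) g t) t := by
    intro g hg k t
    rw [iteratedDeriv_succ]
    exact ((hg.differentiable_iteratedDeriv k (by exact_mod_cast WithTop.coe_lt_top k)) t).hasDerivAt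
  have gs : ∀ g : ℝ → ℝ, ∀ S : Set ℝ, tsupport g ⊆ S → ∀ k, ∀ t ∉ S, iteratedDeriv k g t = 0 := by
    intro g S hS k t ht
    have : t ∉ tsupport g := fun h => ht (hS h)
    have e : g =ᶠ[𝓝 t] fun _ => 0 := notMem_tsupport_iff_eventuallyEq.1 this
    rw [e.iteratedDeriv_eq k]
    simp
  have gb : ∀ g : ℝ → ℝ, ContDiff ℝ (⊤ : ℕ∞) g → ∀ c r, tsupport g ⊆ Metric.closedBall c r →
      ∀ k, ∃ C, ∀ t, ‖iteratedDeriv k g t‖ ≤ C := by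
    intro g hg c r hS k
    have hc : Continuous (iteratedDeriv k g) :=
      continuous_iff_continuousAt.2 fun t => (gd g hg k t).continuousAt
    have : HasCompactSupport (iteratedDeriv k g) :=
      HasCompactSupport.intro (isCompact_closedBall c r) (gs g _ hS k)
    exact this.exists_bound_of_continuous hc
  choose Ca hCa using fun n k => gb (a n) (ha n) _ _ (hta n) k
  choose Cb hCb using fun n k => gb (b n) (hb n) _ _ (htb n) k
  have hA0 : ∀ n k, 0 ≤ Ca n k := fun n k => (norm_nonneg _).trans (hCa n k 0)
  have hB0 : ∀ n k, 0 ≤ Cb n k := fun n k => (norm_nonneg _).trans (hCb n k 0)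
  refine ⟨fun n k => iteratedDeriv k (a n), fun n k => iteratedDeriv k (b n),
    fun n => gd _ (ha n), fun n => gd _ (hb n), fun n => gs _ _ (hta n), fun n => gs _ _ (htb n),
    ?_, fun n => 1 + ∑ k ∈ Finset.range (n+1), (Ca n k + Cb n k), ?_, ?_⟩
  · intro n t ht
    have h1 : φ n t = 1 := (φ n).one_of_mem_closedBall ht
    simp [a, b, h1]
  · intro n
    have := Finset.sum_nonneg fun k (_ : k ∈ Finset.range (n+1)) => add_nonneg (hA0 n k) (hB0 n k)
    linarith
  · intro n k hk t
    have := Finset.single_le_sum (fun k (_ : k ∈ Finset.range (n+1)) =>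
      add_nonneg (hA0 n k) (hB0 n k)) (Finset.mem_range.2 (Nat.lt_succ_of_le hk))
    have h1 := hCa n k t
    have h2 := hCb n k t
    rw [Real.norm_eq_abs] at h1 h2
    have h3 := hA0 n k
    have h4 := hB0 n k
    constructor <;> linarith

lemma local_holder_aux
    {E : Type*} [NormedAddCommGroup E] [NormedSpace ℝ E]
    {F : Type*} [NormedAddCommGroup F] [NormedSpace ℝ F]
    {α : ℝ} (hα : α ∈ Set.Ioc (0 : ℝ) 1)
    {U : Set E} (hU : IsOpen U) (f : E → F)
    (hf : ∀ γ : ℝ → E, ContDiff ℝ (⊤ : ℕ∞) γ → Set.range γ ⊆ U →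
      ∀ t₀ : ℝ, ∃ V ∈ 𝓝 t₀, ∃ C ≥ (0 : ℝ),
        ∀ s ∈ V, ∀ t ∈ V, ‖f (γ t) - f (γ s)‖ ≤ C * |t - s| ^ α) (x : E) (hx : x ∈ U) :
    ∃ r > (0:ℝ), ∃ C ≥ (0:ℝ), ∀ y ∈ Metric.ball x r, ∀ z ∈ Metric.ball x r,
      ‖f z - f y‖ ≤ C * ‖z - y‖ ^ α := by
  by_contra hcon
  push Not at hcon
  obtain ⟨ρ, hρ, hρU⟩ := Metric.isOpen_iff.1 hU x hx
  obtain ⟨A, B, hA, hB, hAs, hBs, hAB, M, hM, hMb⟩ := scalar_aux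
  let δ : ℕ → ℝ := fun n => (ρ/2 * (1/4:ℝ)^n) / (2 * M n)
  have hδ : ∀ n, 0 < δ n := fun n => by have := hM n; positivity
  let ε : ℕ → ℝ := fun n => min (δ n) (δ n * ((1/2:ℝ)^n/8) / 2)
  have hε : ∀ n, 0 < ε n := fun n => by have := hδ n; positivity
  have hC : ∀ n : ℕ, 0 ≤ (n:ℝ) / (δ n)^α := fun n => by have := hδ n; positivity
  choose y hy z hz hyz using fun n => hcon (ε n) (hε n) _ (hC n)
  have hne : ∀ n, 0 < ‖z n - y n‖ := by
    intro n
    rw [norm_pos_iff]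
    intro h0
    have := hyz n
    rw [sub_eq_zero.1 h0] at this
    simp [Real.zero_rpow hα.1.ne'] at this
  let v : ℕ → E := fun n => (δ n / ‖z n - y n‖) • (z n - y n)
  let s : ℕ → ℝ := fun n => ‖z n - y n‖ / δ n
  have hv : ∀ n, ‖v n‖ = δ n := by
    intro n
    have := hne n
    simp only [v]
    rw [norm_smul, Real.norm_of_nonneg (div_nonneg (hδ n).le this.le)]
    field_simp
  have hsv : ∀ n, s n • v n = z n - y n := by
    intro n
    have h1 := (hne n).ne'
    have h2 := (hδ n).ne'
    simp only [v, s]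
    rw [smul_smul, show ‖z n - y n‖ / δ n * (δ n / ‖z n - y n‖) = 1 by field_simp, one_smul]
  have hs0 : ∀ n, 0 ≤ s n := fun n => div_nonneg (norm_nonneg _) (hδ n).le
  have hs1 : ∀ n, s n ≤ (1/2:ℝ)^n/8 := by
    intro n
    simp only [s]
    rw [div_le_iff₀ (hδ n)]
    have h1 : ‖z n - y n‖ ≤ dist (z n) x + dist (y n) x := by
      rw [← dist_eq_norm]; exact dist_triangle_right _ _ _
    have h2 := Metric.mem_ball.1 (hy n)
    have h3 := Metric.mem_ball.1 (hz n)
    have h4 : ε n ≤ δ n * ((1/2:ℝ)^n/8) / 2 := min_le_right _ _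
    linarith
  have hay : ∀ n, ‖y n - x‖ ≤ δ n := by
    intro n
    have h2 := Metric.mem_ball.1 (hy n)
    rw [dist_eq_norm] at h2
    exact h2.le.trans (min_le_left _ _)
  obtain ⟨G, hGs, hGb, hGe⟩ := glue_aux
    (fun n k t => A n k t • (y n - x) + B n k t • v n) (ρ/2) (by positivity)
    (fun n k t => ((hA n k t).smul_const _).add ((hB n k t).smul_const _))
    (fun n k t ht => by simp [hAs n k t ht, hBs n k t ht])
    (fun n k hk t => by
      obtain ⟨h1, h2⟩ := hMb n k hk t
      calc ‖A n k t • (y n - x) + B n k t • v n‖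
          ≤ |A n k t| * ‖y n - x‖ + |B n k t| * ‖v n‖ := by
            refine (norm_add_le _ _).trans ?_
            rw [norm_smul, norm_smul, Real.norm_eq_abs, Real.norm_eq_abs]
        _ ≤ M n * δ n + M n * δ n := by
            have := hM n
            gcongr
            · exact hay n
            · exact (hv n).le
        _ = ρ/2 * (1/4:ℝ)^n := by
            have := (hM n).ne'
            simp only [δ]
            field_simp
            ring)
  obtain ⟨V, hV, C, hC0, hVC⟩ := hf (fun t => x + G t) (contDiff_const.add hGs) (by
    rintro _ ⟨t, rfl⟩
    apply hρU
    have := hGb t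
    rw [Metric.mem_ball, dist_eq_norm]
    simp only [add_sub_cancel_left]
    linarith) 0
  obtain ⟨η, hη, hηV⟩ := Metric.mem_nhds_iff.1 hV
  obtain ⟨N, hN⟩ := exists_pow_lt_of_lt_one (show (0:ℝ) < η/2 by linarith)
        (show (1/2:ℝ) < 1 by norm_num)
  obtain ⟨N', hN'⟩ := exists_nat_ge C
  let n := max N N'
  have hn1 : (1/2:ℝ)^n ≤ (1/2:ℝ)^N :=
    pow_le_pow_of_le_one (by norm_num) (by norm_num) (le_max_left _ _)
  have hn2 : C ≤ n := hN'.trans (by exact_mod_cast le_max_right _ _)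
  have hp : (0:ℝ) < (1/2:ℝ)^n := by positivity
  have m0 : (1/2:ℝ)^n ∈ Metric.closedBall ((1/2:ℝ)^n) ((1/2:ℝ)^n/8) :=
    Metric.mem_closedBall_self (by positivity)
  have m1 : (1/2:ℝ)^n + s n ∈ Metric.closedBall ((1/2:ℝ)^n) ((1/2:ℝ)^n/8) := by
    rw [Metric.mem_closedBall, Real.dist_eq, add_sub_cancel_left, abs_of_nonneg (hs0 n)]
    exact hs1 n
  have sub : Metric.closedBall ((1/2:ℝ)^n) ((1/2:ℝ)^n/8) ⊆
      Metric.closedBall ((1/2:ℝ)^n) ((1/2:ℝ)^n/4) :=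
    Metric.closedBall_subset_closedBall (by linarith)
  have e0 : x + G ((1/2:ℝ)^n) = y n := by
    rw [hGe n _ (sub m0), (hAB n _ m0).1, (hAB n _ m0).2]
    simp
  have e1 : x + G ((1/2:ℝ)^n + s n) = z n := by
    rw [hGe n _ (sub m1), (hAB n _ m1).1, (hAB n _ m1).2, add_sub_cancel_left, hsv]
    simp
  have inV : ∀ t, 0 ≤ t → t < η → t ∈ V := by
    intro t h0 h1
    apply hηV
    rw [Metric.mem_ball, Real.dist_eq, sub_zero, abs_of_nonneg h0]
    exact h1
  have hfin := hVC _ (inV ((1/2:ℝ)^n) hp.le (by linarith)) _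
    (inV ((1/2:ℝ)^n + s n) (by linarith [hs0 n]) (by linarith [hs1 n]))
  simp only [e0, e1, add_sub_cancel_left, abs_of_nonneg (hs0 n)] at hfin
  have h5 := hyz n
  have h6 : (n:ℝ) / (δ n)^α * ‖z n - y n‖^α = n * (s n)^α := by
    simp only [s]
    rw [Real.div_rpow (norm_nonneg _) (hδ n).le]
    ring
  rw [h6] at h5
  have h7 : C * (s n)^α ≤ n * (s n)^α :=
    mul_le_mul_of_nonneg_right hn2 (Real.rpow_nonneg (hs0 n) _)
  linarith

/-- If `f : U → F` takes smooth curves with image in `U` to locally `α`-Hölder curves,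
then it also takes Lipschitz curves with image in `U` to locally `α`-Hölder curves. -/
theorem holder_along_lipschitz_curves
    {E : Type*} [NormedAddCommGroup E] [NormedSpace ℝ E]
    {F : Type*} [NormedAddCommGroup F] [NormedSpace ℝ F]
    {α : ℝ} (hα : α ∈ Set.Ioc (0 : ℝ) 1)
    {U : Set E} (hU : IsOpen U) (f : E → F)
    (hf : ∀ γ : ℝ → E, ContDiff ℝ (⊤ : ℕ∞) γ → Set.range γ ⊆ U →
      ∀ t₀ : ℝ, ∃ V ∈ 𝓝 t₀, ∃ C ≥ (0 : ℝ),
        ∀ s ∈ V, ∀ t ∈ V, ‖f (γ t) - f (γ s)‖ ≤ C * |t - s| ^ α) :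
    ∀ η : ℝ → E, (∃ L : ℝ≥0, LipschitzWith L η) → Set.range η ⊆ U →
      ∀ t₀ : ℝ, ∃ V ∈ 𝓝 t₀, ∃ C ≥ (0 : ℝ),
        ∀ s ∈ V, ∀ t ∈ V, ‖f (η t) - f (η s)‖ ≤ C * |t - s| ^ α := by
  rintro η ⟨L, hL⟩ hηU t₀
  obtain ⟨r, hr, C, hC, h⟩ := local_holder_aux hα hU f hf (η t₀) (hηU ⟨t₀, rfl⟩)
  refine ⟨η ⁻¹' Metric.ball (η t₀) r,
    hL.continuous.continuousAt (Metric.ball_mem_nhds _ hr), C * (L:ℝ)^α, by positivity, ?_⟩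
  intro s hs t ht
  refine (h _ hs _ ht).trans ?_
  rw [mul_assoc, ← Real.mul_rpow (NNReal.coe_nonneg L) (abs_nonneg _)]
  have h1 : ‖η t - η s‖ ≤ L * |t - s| := by
    have := hL.dist_le_mul t s
    rwa [dist_eq_norm, Real.dist_eq] at this
  exact mul_le_mul_of_nonneg_left (Real.rpow_le_rpow (norm_nonneg _) h1 hα.1.le) hC
end

section
/- Let E, F and V be real normed spaces, U ⊆ E and W ⊆ F open sets, and α, β ∈ (0,1]. Let f : U → F be a map with f(U) ⊆ W such that f ∘ γ is locally Hölder of exponent α for every C^∞ curve γ : ℝ → E with image contained in U, and let g : W → V be a map such that g ∘ δ is locally Hölder of exponent β for every C^∞ curve δ : ℝ → F with image contained in W. Then (g ∘ f) ∘ γ is locally Hölder of exponent α·β for every C^∞ curve γ : ℝ → E with image contained in U. -/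
open scoped Topology

namespace ConvHolder

open Filter

lemma arg_unique {t : ℝ} {n m : ℕ} (hn : |4 * (2 ^ n * t - 1)| ≤ 1)
    (hm : |4 * (2 ^ m * t - 1)| ≤ 1) : n = m := by
  have key : ∀ n m : ℕ, |4 * (2 ^ n * t - 1)| ≤ 1 → |4 * (2 ^ m * t - 1)| ≤ 1 → ¬ n < m := by
    intro n m hn hm h
    obtain ⟨k, rfl⟩ := Nat.exists_eq_add_of_lt h
    rw [abs_le] at hn hm
    have h1 : (1 : ℝ) ≤ 2 ^ k := one_le_pow₀ (by norm_num)
    have e : (2 : ℝ) ^ (n + k + 1) * t = 2 * 2 ^ k * (2 ^ n * t) := by ring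
    rw [e] at hm
    nlinarith [mul_nonneg (sub_nonneg.2 h1) (show (0 : ℝ) ≤ 2 ^ n * t by linarith)]
  rcases lt_trichotomy n m with h | h | h
  · exact absurd h (key n m hn hm)
  · exact h
  · exact absurd h (key m n hm hn)

variable {F : Type*} [NormedAddCommGroup F] [NormedSpace ℝ F]

/-- The sum of rescaled bumps. -/
noncomputable def S (p : ℝ → ℝ) (a : ℕ → F) (t : ℝ) : F :=
  ∑' n, p (4 * (2 ^ n * t - 1)) • a n

lemma S_eq {p : ℝ → ℝ} (hp : ∀ x, 1 < |x| → p x = 0) (a : ℕ → F) {t : ℝ} {n : ℕ}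
    (hn : |4 * (2 ^ n * t - 1)| ≤ 1) : S p a t = p (4 * (2 ^ n * t - 1)) • a n := by
  unfold S
  apply tsum_eq_single
  intro m hm
  rw [hp, zero_smul]
  by_contra h
  exact hm (arg_unique (not_lt.1 h) hn)

lemma S_unif {p : ℝ → ℝ} (hp : ∀ x, 1 < |x| → p x = 0) (hc : Continuous p) {a : ℕ → F}
    (ha : Tendsto (fun n => ‖a n‖) atTop (𝓝 0)) :
    TendstoUniformly (fun N t => ∑ n ∈ Finset.range N, p (4 * (2 ^ n * t - 1)) • a n)
      (S p a) atTop := by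
  obtain ⟨B, hB⟩ := (isCompact_Icc (a := (-1 : ℝ)) (b := 1)).exists_bound_of_continuousOn
    hc.continuousOn
  have hB0 : 0 ≤ B := (norm_nonneg _).trans (hB 0 (by norm_num))
  rw [Metric.tendstoUniformly_iff]
  intro ε hε
  have h1 : ∀ᶠ n in atTop, ‖a n‖ < ε / (B + 1) := ha.eventually_lt_const (by positivity)
  obtain ⟨M, hM⟩ := eventually_atTop.1 h1
  filter_upwards [eventually_ge_atTop M] with N hN t
  by_cases h : ∃ n, |4 * (2 ^ n * t - 1)| ≤ 1
  · obtain ⟨n, hn⟩ := h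
    have hz : ∀ m, m ≠ n → p (4 * (2 ^ m * t - 1)) • a m = 0 := by
      intro m hm
      rw [hp, zero_smul]
      by_contra h
      exact hm (arg_unique (not_lt.1 h) hn)
    rw [S_eq hp a hn]
    by_cases hnN : n < N
    · rw [Finset.sum_eq_single n (fun m _ hm => hz m hm)
        (fun h => absurd (Finset.mem_range.2 hnN) h), dist_self]
      exact hε
    · rw [Finset.sum_eq_zero, dist_zero_right, norm_smul]
      · have h2 := hM n (by omega)
        have h3 := hB _ (abs_le.1 hn)
        rw [lt_div_iff₀ (by positivity)] at h2
        nlinarith [norm_nonneg (a n), mul_le_mul_of_nonneg_right h3 (norm_nonneg (a n))]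
      · intro m hm
        apply hz
        rintro rfl
        exact hnN (Finset.mem_range.1 hm)
  · push Not at h
    have hz : ∀ m, p (4 * (2 ^ m * t - 1)) • a m = 0 := fun m => by rw [hp _ (h m), zero_smul]
    simp [S, hz, hε]

lemma deriv_supp {p : ℝ → ℝ} (hp : ∀ x, 1 < |x| → p x = 0) :
    ∀ x, 1 < |x| → deriv p x = 0 := by
  intro x hx
  have ho : IsOpen {x : ℝ | 1 < |x|} := isOpen_lt continuous_const continuous_abs
  have : p =ᶠ[𝓝 x] fun _ => 0 := by
    filter_upwards [ho.mem_nhds hx] with y hy using hp y hy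
  rw [this.deriv_eq]; simp

lemma S_hasDerivAt {p : ℝ → ℝ} (hp : ∀ x, 1 < |x| → p x = 0) (hc : ContDiff ℝ (⊤ : ℕ∞) p)
    {a : ℕ → F} (ha : ∀ k : ℕ, Tendsto (fun n => (4 * 2 ^ n : ℝ) ^ k * ‖a n‖) atTop (𝓝 0))
    (t : ℝ) : HasDerivAt (S p a) (S (deriv p) (fun n => (4 * 2 ^ n : ℝ) • a n) t) t := by
  have hd : ContDiff ℝ (⊤ : ℕ∞) (deriv p) := (contDiff_infty_iff_deriv.1 hc).2
  have u1 := S_unif (deriv_supp hp) hd.continuous (a := fun n => (4 * 2 ^ n : ℝ) • a n)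
    (by simpa [norm_smul] using ha 1)
  have u0 := S_unif hp hc.continuous (a := a) (by simpa using ha 0)
  refine hasDerivAt_of_tendstoUniformly u1 (Eventually.of_forall fun N x => ?_)
    (fun x => u0.tendsto_at x) t
  apply HasDerivAt.fun_sum
  intro n _
  have h1 : HasDerivAt (fun x : ℝ => 4 * (2 ^ n * x - 1)) (4 * 2 ^ n) x := by
    have := (((hasDerivAt_id x).const_mul ((2 : ℝ) ^ n)).sub_const 1).const_mul 4
    simpa using this
  have h2 : HasDerivAt p (deriv p (4 * (2 ^ n * x - 1))) (4 * (2 ^ n * x - 1)) :=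
    ((contDiff_infty_iff_deriv.1 hc).1 _).hasDerivAt
  have := (h2.comp x h1).smul_const (a n)
  rw [smul_smul]
  exact this

lemma S_contDiff_nat (N : ℕ) : ∀ {p : ℝ → ℝ} (_ : ∀ x, 1 < |x| → p x = 0)
    (_ : ContDiff ℝ (⊤ : ℕ∞) p) {a : ℕ → F}
    (_ : ∀ k : ℕ, Tendsto (fun n => (4 * 2 ^ n : ℝ) ^ k * ‖a n‖) atTop (𝓝 0)),
    ContDiff ℝ N (S p a) := by
  induction N with
  | zero =>
    intro p hp hc a ha
    exact contDiff_zero.2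
      (continuous_iff_continuousAt.2 fun t => (S_hasDerivAt hp hc ha t).continuousAt)
  | succ N ih =>
    intro p hp hc a ha
    have hd : deriv (S p a) = S (deriv p) (fun n => (4 * 2 ^ n : ℝ) • a n) :=
      funext fun t => (S_hasDerivAt hp hc ha t).deriv
    push_cast
    rw [contDiff_succ_iff_deriv, hd]
    refine ⟨fun t => (S_hasDerivAt hp hc ha t).differentiableAt, by simp, ?_⟩
    refine ih (deriv_supp hp) (contDiff_infty_iff_deriv.1 hc).2 fun k => ?_
    refine (ha (k + 1)).congr fun n => ?_
    rw [norm_smul, Real.norm_of_nonneg (by positivity)]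
    ring

lemma S_contDiff {p : ℝ → ℝ} (hp : ∀ x, 1 < |x| → p x = 0) (hc : ContDiff ℝ (⊤ : ℕ∞) p)
    {a : ℕ → F} (ha : ∀ n, ‖a n‖ ≤ 1 / (n.factorial : ℝ)) :
    ContDiff ℝ (⊤ : ℕ∞) (S p a) := by
  refine contDiff_infty.2 fun N => S_contDiff_nat N hp hc fun k => ?_
  have h := (FloorSemiring.tendsto_pow_div_factorial_atTop ((2 : ℝ) ^ k)).const_mul ((4 : ℝ) ^ k)
  rw [mul_zero] at h
  refine squeeze_zero (fun n => by positivity) (fun n => ?_) h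
  calc (4 * 2 ^ n : ℝ) ^ k * ‖a n‖ ≤ (4 * 2 ^ n : ℝ) ^ k * (1 / (n.factorial : ℝ)) := by
        gcongr; exact ha n
    _ = _ := by rw [mul_pow, ← pow_mul, ← pow_mul, mul_comm n k]; ring

lemma S_zero {p : ℝ → ℝ} (hp : ∀ x, 1 < |x| → p x = 0) (a : ℕ → F) : S p a 0 = 0 := by
  have : ∀ n : ℕ, p (4 * (2 ^ n * 0 - 1)) • a n = 0 := fun n => by
    rw [hp _ (by norm_num), zero_smul]
  simp only [S, this, tsum_zero]

lemma locally_holder {V : Type*} [NormedAddCommGroup V] {β : ℝ} (hβ : β ∈ Set.Ioc (0 : ℝ) 1)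
    {W : Set F} (hW : IsOpen W) (g : F → V)
    (hg : ∀ δ : ℝ → F, ContDiff ℝ (⊤ : ℕ∞) δ → Set.range δ ⊆ W →
      ∀ t₀ : ℝ, ∃ I ∈ 𝓝 t₀, ∃ C ≥ (0 : ℝ),
        ∀ s ∈ I, ∀ t ∈ I, ‖g (δ t) - g (δ s)‖ ≤ C * |t - s| ^ β)
    {x₀ : F} (hx₀ : x₀ ∈ W) :
    ∃ I ∈ 𝓝 x₀, ∃ C ≥ (0 : ℝ), ∀ y ∈ I, ∀ z ∈ I, ‖g z - g y‖ ≤ C * ‖z - y‖ ^ β := by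
  by_contra hcon
  push Not at hcon
  have hfac : ∀ n : ℕ, (0 : ℝ) < n.factorial := fun n => by exact_mod_cast n.factorial_pos
  have hcon' := fun n : ℕ => hcon (Metric.ball x₀ (1 / (4 * (n.factorial : ℝ))))
    (Metric.ball_mem_nhds _ (by have := hfac n; positivity)) (n * n.factorial) (by positivity)
  choose y hy z hz hyz using hcon'
  have hne : ∀ n, z n - y n ≠ 0 := by
    intro n h
    have h1 := hyz n
    rw [sub_eq_zero] at h
    rw [h] at h1
    simp only [sub_self, norm_zero] at h1
    have : (0 : ℝ) ≤ n * n.factorial * 0 ^ β := by positivity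
    linarith
  have hpos : ∀ n, 0 < ‖z n - y n‖ := fun n => norm_pos_iff.2 (hne n)
  have hdist : ∀ n, ‖z n - y n‖ ≤ 1 / (2 * (n.factorial : ℝ)) := by
    intro n
    have h1 := hy n
    have h2 := hz n
    rw [Metric.mem_ball] at h1 h2
    rw [← dist_eq_norm]
    have h3 := dist_triangle_right (z n) (y n) x₀
    have : 1 / (2 * (n.factorial : ℝ)) = 1 / (4 * (n.factorial : ℝ)) + 1 / (4 * (n.factorial : ℝ)) := by
      have := hfac n
      field_simp; norm_num
    linarith
  -- the bump
  let χ : ContDiffBump (0 : ℝ) := ⟨1 / 2, 1, by norm_num, by norm_num⟩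
  have hχs : ∀ x, 1 < |x| → χ x = 0 := fun x hx =>
    χ.zero_of_le_dist (by rw [Real.dist_eq, sub_zero]; exact hx.le)
  have hχ1 : ∀ x, |x| ≤ 1 / 2 → χ x = 1 := fun x hx =>
    χ.one_of_mem_closedBall (by rw [mem_closedBall_zero_iff]; exact hx)
  have hχc : ContDiff ℝ (⊤ : ℕ∞) χ := χ.contDiff
  let q : ℝ → ℝ := fun x => x * χ x
  have hqs : ∀ x, 1 < |x| → q x = 0 := fun x hx => by simp only [q, hχs x hx, mul_zero]
  have hqc : ContDiff ℝ (⊤ : ℕ∞) q := contDiff_id.mul hχc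
  let a : ℕ → F := fun n => y n - x₀
  let d : ℕ → F := fun n => (1 / (n.factorial : ℝ) / ‖z n - y n‖) • (z n - y n)
  have ha : ∀ n, ‖a n‖ ≤ 1 / (n.factorial : ℝ) := by
    intro n
    have h1 := hy n
    rw [Metric.mem_ball, dist_eq_norm] at h1
    refine h1.le.trans ?_
    have := hfac n
    gcongr
    linarith
  have hd : ∀ n, ‖d n‖ ≤ 1 / (n.factorial : ℝ) := by
    intro n
    have := hfac n
    have := hpos n
    simp only [d]
    rw [norm_smul, Real.norm_of_nonneg (by positivity), div_mul_cancel₀ _ this.ne']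
  let c : ℝ → F := fun t => x₀ + (S χ a t + S q d t)
  have hc : ContDiff ℝ (⊤ : ℕ∞) c :=
    contDiff_const.add ((S_contDiff hχs hχc ha).add (S_contDiff hqs hqc hd))
  have hc0 : c 0 = x₀ := by simp only [c, S_zero hχs, S_zero hqs, add_zero]
  have hcW : c ⁻¹' W ∈ 𝓝 (0 : ℝ) :=
    hc.continuous.continuousAt.preimage_mem_nhds (hW.mem_nhds (by rw [hc0]; exact hx₀))
  obtain ⟨ε, hε, hball⟩ := Metric.mem_nhds_iff.1 hcW
  let ψ : ContDiffBump (0 : ℝ) := ⟨ε / 2, ε, by positivity, by linarith⟩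
  let θ : ℝ → ℝ := fun t => t * ψ t
  have hθc : ContDiff ℝ (⊤ : ℕ∞) θ := contDiff_id.mul ψ.contDiff
  have hθ : ∀ t, θ t ∈ Metric.ball (0 : ℝ) ε := by
    intro t
    rw [mem_ball_zero_iff]
    by_cases h : |t| < ε
    · simp only [θ]
      rw [Real.norm_eq_abs, abs_mul, abs_of_nonneg (ψ.nonneg' t)]
      have h1 : ψ t ≤ 1 := ψ.le_one
      have h2 : 0 ≤ ψ t := ψ.nonneg' t
      nlinarith [abs_nonneg t]
    · have : ψ t = 0 := ψ.zero_of_le_dist (by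
        rw [Real.dist_eq, sub_zero]; exact not_lt.1 h)
      simp only [θ, this, mul_zero, norm_zero, hε]
  have hθ1 : ∀ t, |t| ≤ ε / 2 → θ t = t := fun t ht => by
    have : ψ t = 1 := ψ.one_of_mem_closedBall (by rw [mem_closedBall_zero_iff]; exact ht)
    simp only [θ, this, mul_one]
  obtain ⟨I, hI, C, hC, hH⟩ := hg (fun t => c (θ t)) (hc.comp hθc)
    (by rintro _ ⟨t, rfl⟩; exact hball (hθ t)) 0
  obtain ⟨η, hη, hIb⟩ := Metric.mem_nhds_iff.1 hI
  -- choose large n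
  have hlim : Tendsto (fun n : ℕ => 2 * (1 / 2 : ℝ) ^ n) atTop (𝓝 0) := by
    have := (tendsto_pow_atTop_nhds_zero_of_lt_one (r := (1 / 2 : ℝ)) (by norm_num)
      (by norm_num)).const_mul 2
    simpa using this
  obtain ⟨n, hn1, hn2⟩ := ((hlim.eventually_lt_const
    (show 0 < min η (ε / 2) by positivity)).and
      (tendsto_natCast_atTop_atTop.eventually_ge_atTop C)).exists
  have hnη := hn1.trans_le (min_le_left _ _)
  have hnε := hn1.trans_le (min_le_right _ _)
  -- parameter values
  let σ : ℝ := ‖z n - y n‖ * n.factorial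
  have hfn := hfac n
  have hσ0 : 0 ≤ σ := by positivity
  have hσ : σ ≤ 1 / 2 := by
    have := hdist n
    rw [le_div_iff₀ (by positivity)] at this
    simp only [σ]
    linarith
  have hev : ∀ s : ℝ, 0 ≤ s → s ≤ 1 / 2 →
      (1 + s / 4) * (1 / 2) ^ n ∈ I ∧ c (θ ((1 + s / 4) * (1 / 2) ^ n)) = y n + s • d n := by
    intro s hs0 hs1
    have hp2 : (0 : ℝ) < (1 / 2) ^ n := by positivity
    have hle : (1 + s / 4) * (1 / 2) ^ n ≤ 2 * (1 / 2 : ℝ) ^ n := by gcongr; linarith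
    have habs : |(1 + s / 4) * (1 / 2 : ℝ) ^ n| = (1 + s / 4) * (1 / 2) ^ n :=
      abs_of_nonneg (by positivity)
    refine ⟨hIb ?_, ?_⟩
    · rw [mem_ball_zero_iff, Real.norm_eq_abs, habs]; linarith
    · rw [hθ1 _ (by rw [habs]; linarith)]
      have harg : 4 * (2 ^ n * ((1 + s / 4) * (1 / 2 : ℝ) ^ n) - 1) = s := by
        have : (2 : ℝ) ^ n * (1 / 2) ^ n = 1 := by rw [← mul_pow]; norm_num
        linear_combination (4 * (1 + s / 4)) * this
      have hsa : |s| ≤ 1 / 2 := by rw [abs_of_nonneg hs0]; exact hs1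
      have hb : |4 * (2 ^ n * ((1 + s / 4) * (1 / 2 : ℝ) ^ n) - 1)| ≤ 1 := by
        rw [harg]; linarith
      simp only [c]
      rw [S_eq hχs a hb, S_eq hqs d hb, harg]
      simp only [q, hχ1 s hsa, a, one_smul, mul_one]
      abel
  obtain ⟨m0, e0⟩ := hev 0 le_rfl (by norm_num)
  obtain ⟨m1, e1⟩ := hev σ hσ0 hσ
  have hfin := hH _ m0 _ m1
  have hzz : y n + σ • d n = z n := by
    have : σ * (1 / (n.factorial : ℝ) / ‖z n - y n‖) = 1 := by
      have := hpos n
      simp only [σ]; field_simp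
    simp only [d]
    rw [smul_smul, this, one_smul]; abel
  simp only [e0, e1, hzz, zero_smul, add_zero] at hfin
  have ht : |(1 + σ / 4) * (1 / 2 : ℝ) ^ n - (1 + 0 / 4) * (1 / 2) ^ n| ≤ σ := by
    have e : (1 + σ / 4) * (1 / 2 : ℝ) ^ n - (1 + 0 / 4) * (1 / 2) ^ n
      = σ / 4 * (1 / 2) ^ n := by ring
    rw [e, abs_of_nonneg (by positivity)]
    have : (1 / 2 : ℝ) ^ n ≤ 1 := pow_le_one₀ (by norm_num) (by norm_num)
    nlinarith
  have hb0 := hβ.1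
  have h1 : |(1 + σ / 4) * (1 / 2 : ℝ) ^ n - (1 + 0 / 4) * (1 / 2) ^ n| ^ β ≤
      ‖z n - y n‖ ^ β * n.factorial := by
    calc _ ≤ σ ^ β := Real.rpow_le_rpow (abs_nonneg _) ht hb0.le
      _ = ‖z n - y n‖ ^ β * (n.factorial : ℝ) ^ β :=
        Real.mul_rpow (norm_nonneg _) hfn.le
      _ ≤ ‖z n - y n‖ ^ β * n.factorial := by
        gcongr
        have h1 : (1 : ℝ) ≤ n.factorial := by exact_mod_cast n.factorial_pos
        calc (n.factorial : ℝ) ^ β ≤ (n.factorial : ℝ) ^ (1 : ℝ) :=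
              Real.rpow_le_rpow_of_exponent_le h1 hβ.2
          _ = _ := Real.rpow_one _
  have h2 := hyz n
  simp only [add_zero, zero_div] at hfin h1
  have h3 : C * |(1 + σ / 4) * (1 / 2 : ℝ) ^ n - 1 * (1 / 2) ^ n| ^ β ≤
      n * (‖z n - y n‖ ^ β * n.factorial) :=
    mul_le_mul hn2 h1 (by positivity) (by positivity)
  have h4 : (n : ℝ) * (‖z n - y n‖ ^ β * n.factorial) = n * n.factorial * ‖z n - y n‖ ^ β := by
    ring
  linarith

end ConvHolder

/-- If `f : U → W ⊆ F` takes smooth curves with image in `U` to locally `α`-Hölder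
curves and `g : W → V` takes smooth curves with image in `W` to locally `β`-Hölder
curves, then `g ∘ f` takes smooth curves with image in `U` to locally `α·β`-Hölder
curves. -/
theorem comp_conveniently_holder
    {E : Type*} [NormedAddCommGroup E] [NormedSpace ℝ E]
    {F : Type*} [NormedAddCommGroup F] [NormedSpace ℝ F]
    {V : Type*} [NormedAddCommGroup V] [NormedSpace ℝ V]
    {α β : ℝ} (hα : α ∈ Set.Ioc (0 : ℝ) 1) (hβ : β ∈ Set.Ioc (0 : ℝ) 1)
    {U : Set E} (hU : IsOpen U) {W : Set F} (hW : IsOpen W)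
    (f : E → F) (hfW : f '' U ⊆ W)
    (g : F → V)
    (hf : ∀ γ : ℝ → E, ContDiff ℝ (⊤ : ℕ∞) γ → Set.range γ ⊆ U →
      ∀ t₀ : ℝ, ∃ I ∈ 𝓝 t₀, ∃ C ≥ (0 : ℝ),
        ∀ s ∈ I, ∀ t ∈ I, ‖f (γ t) - f (γ s)‖ ≤ C * |t - s| ^ α)
    (hg : ∀ δ : ℝ → F, ContDiff ℝ (⊤ : ℕ∞) δ → Set.range δ ⊆ W →
      ∀ t₀ : ℝ, ∃ I ∈ 𝓝 t₀, ∃ C ≥ (0 : ℝ),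
        ∀ s ∈ I, ∀ t ∈ I, ‖g (δ t) - g (δ s)‖ ≤ C * |t - s| ^ β) :
    ∀ γ : ℝ → E, ContDiff ℝ (⊤ : ℕ∞) γ → Set.range γ ⊆ U →
      ∀ t₀ : ℝ, ∃ I ∈ 𝓝 t₀, ∃ C ≥ (0 : ℝ),
        ∀ s ∈ I, ∀ t ∈ I, ‖g (f (γ t)) - g (f (γ s))‖ ≤ C * |t - s| ^ (α * β) := by
  intro γ hγ hγU t₀
  have hx₀ : f (γ t₀) ∈ W := hfW ⟨γ t₀, hγU ⟨t₀, rfl⟩, rfl⟩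
  obtain ⟨N, hN, K, hK, hHK⟩ := ConvHolder.locally_holder hβ hW g hg hx₀
  obtain ⟨I, hI, C, hC, hH⟩ := hf γ hγ hγU t₀
  have hcont : Filter.Tendsto (fun t => f (γ t)) (𝓝 t₀) (𝓝 (f (γ t₀))) := by
    rw [tendsto_iff_norm_sub_tendsto_zero]
    have hlim : Filter.Tendsto (fun t : ℝ => C * |t - t₀| ^ α) (𝓝 t₀) (𝓝 0) := by
      have hc : Continuous (fun t : ℝ => C * |t - t₀| ^ α) :=
        continuous_const.mul ((continuous_id.sub continuous_const).abs.rpow_const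
          fun _ => Or.inr hα.1.le)
      have := hc.tendsto t₀
      simpa [Real.zero_rpow hα.1.ne'] using this
    refine squeeze_zero' (Filter.Eventually.of_forall fun t => norm_nonneg _) ?_ hlim
    filter_upwards [hI] with t ht using hH t₀ (mem_of_mem_nhds hI) t ht
  refine ⟨I ∩ (fun t => f (γ t)) ⁻¹' N, Filter.inter_mem hI (hcont hN), K * C ^ β,
    by positivity, ?_⟩
  rintro s ⟨hs, hs'⟩ t ⟨ht, ht'⟩
  have hb0 := hβ.1
  calc _ ≤ K * ‖f (γ t) - f (γ s)‖ ^ β := hHK _ hs' _ ht'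
    _ ≤ K * (C * |t - s| ^ α) ^ β := by
      gcongr
      exact hH s hs t ht
    _ = K * C ^ β * |t - s| ^ (α * β) := by
      rw [Real.mul_rpow hC (by positivity), ← Real.rpow_mul (abs_nonneg _), mul_assoc]
end
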